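/- Let t ≥ 2 be an even integer, let G be a 2-connected 2t-regular finite simple graph, and let 𝒪 be a set of pairwise edge-disjoint odd cycles of G. Then there exists an orientation of G such that (i) every vertex of G has even indegree, and (ii) no cycle of 𝒪 is an oriented cycle with respect to this orientation. -/

import Mathlib

open SimpleGraph

namespace PaperFormalization

variable {V : Type*}

/-- The degree of a vertex in a subgraph. -/
noncomputable def sdeg {G : SimpleGraph V} (H : G.Subgraph) (v : V) : ℕ :=
  (H.neighborSet v).ncard

/-- `H` is a `t`-factor of `G`: a spanning subgraph in which every vertex has degree `t`. -/
def IsTFactor {G : SimpleGraph V} (H : G.Subgraph) (t : ℕ) : Prop :=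
  H.IsSpanning ∧ ∀ v : V, sdeg H v = t

/-- A cycle of `G`: a connected 2-regular subgraph. -/
def IsCycleSG {G : SimpleGraph V} (C : G.Subgraph) : Prop :=
  C.Connected ∧ ∀ v ∈ C.verts, sdeg C v = 2

/-- An odd cycle: a cycle with an odd number of edges. -/
def IsOddCycleSG {G : SimpleGraph V} (C : G.Subgraph) : Prop :=
  IsCycleSG C ∧ Odd C.edgeSet.ncard

/-- A family of subgraphs is pairwise edge-disjoint. -/
def PairwiseEdgeDisjoint {G : SimpleGraph V} (𝒪 : Set G.Subgraph) : Prop :=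
  𝒪.Pairwise fun O₁ O₂ => Disjoint O₁.edgeSet O₂.edgeSet

/-- A family of subgraphs is pairwise vertex-disjoint. -/
def PairwiseVertexDisjoint {G : SimpleGraph V} (𝒪 : Set G.Subgraph) : Prop :=
  𝒪.Pairwise fun O₁ O₂ => Disjoint O₁.verts O₂.verts

/-- `G` is `r`-regular. -/
def IsRegular (G : SimpleGraph V) (r : ℕ) : Prop :=
  ∀ v : V, (G.neighborSet v).ncard = r

/-- `G` is 2-connected: connected, at least 3 vertices, and no cut vertex. -/
def TwoConnected [Fintype V] (G : SimpleGraph V) : Prop :=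
  G.Connected ∧ 3 ≤ Fintype.card V ∧ ∀ v : V, (G.induce {u | u ≠ v}).Connected

/-- `G` is `r`-connected: more than `r` vertices and deleting fewer than `r`
vertices leaves it connected. -/
def KConnected [Fintype V] (r : ℕ) (G : SimpleGraph V) : Prop :=
  r < Fintype.card V ∧ ∀ S : Set V, S.ncard < r → (G.induce Sᶜ).Connected

/-- A set of edges is a matching: pairwise non-adjacent edges. -/
def IsMatchingSet (M : Set (Sym2 V)) : Prop :=
  M.Pairwise fun e f => ∀ v : V, v ∈ e → v ∉ f

/-- An orientation of `G`: each edge receives exactly one direction. -/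
structure Orient {W : Type*} (G : SimpleGraph W) where
  dir : W → W → Prop
  adj_iff : ∀ u v : W, G.Adj u v ↔ (dir u v ∨ dir v u)
  asymm : ∀ u v : W, dir u v → ¬ dir v u

/-- The indegree of a vertex with respect to an orientation. -/
noncomputable def indeg {W : Type*} {G : SimpleGraph W} (D : Orient G) (v : W) : ℕ :=
  {u : W | D.dir u v}.ncard

/-- A cycle `C` is an oriented cycle w.r.t. `D` if at every vertex of `C` exactly one
of the two edges of `C` incident with it is directed towards it. -/
def IsOrientedCycle {W : Type*} {G : SimpleGraph W} (D : Orient G) (C : G.Subgraph) : Prop :=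
  ∀ v ∈ C.verts, ∃! u : W, C.Adj u v ∧ D.dir u v

section EvenIndegree

open Finset

theorem even_card_of_involution {α : Type*} (s : Finset α) (f : α → α)
    (hs : ∀ a ∈ s, f a ∈ s) (hne : ∀ a ∈ s, f a ≠ a) (hinv : ∀ a ∈ s, f (f a) = a) :
    Even #s := by
  have h : ∑ _a ∈ s, (1 : ZMod 2) = 0 :=
    Finset.sum_involution (fun a _ => f a) (fun _ _ => by decide) (fun a ha _ => hne a ha)
      hs hinv
  rw [Finset.sum_const, nsmul_one] at h
  exact (ZMod.natCast_eq_zero_iff_even).1 h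

/-- Tutte's theorem for the graph that a symmetric relation induces on a finite set. -/
theorem exists_pairing_or_barrier {N : Type*} [DecidableEq N] (U : Finset N) (r : N → N → Prop)
    (hr : ∀ a b, r a b → r b a) :
    (∃ f : N → N, ∀ n ∈ U, f n ∈ U ∧ f n ≠ n ∧ r n (f n) ∧ f (f n) = n) ∨
    ∃ S ⊆ U, ∃ 𝒦 : Finset (Finset N), #S < #𝒦 ∧ (∀ K ∈ 𝒦, ∀ L ∈ 𝒦, ∀ n ∈ K, n ∈ L → K = L) ∧
      ∀ K ∈ 𝒦, Odd #K ∧ (∀ n ∈ K, n ∈ U ∧ n ∉ S) ∧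
        ∀ n ∈ K, ∀ m ∈ U, m ∉ S → r n m → m ∈ K := by
  classical
  let Γ : SimpleGraph U :=
    { Adj := fun a b => a ≠ b ∧ r a b
      symm := ⟨fun a b h => ⟨h.1.symm, hr _ _ h.2⟩⟩
      loopless := ⟨fun a h => h.1 rfl⟩ }
  by_cases h : ∃ M : Subgraph Γ, M.IsPerfectMatching
  · left
    obtain ⟨M, hM⟩ := h
    rw [Subgraph.isPerfectMatching_iff] at hM
    choose g hg hg' using hM
    refine ⟨fun n => if h : n ∈ U then g ⟨n, h⟩ else n, fun n hn => ?_⟩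
    have hadj := M.adj_sub (hg ⟨n, hn⟩)
    have hgg : g (g ⟨n, hn⟩) = ⟨n, hn⟩ := (hg' _ _ (hg ⟨n, hn⟩).symm).symm
    simp only [hn, dif_pos, Subtype.coe_eta, Finset.coe_mem, hgg, and_true, true_and]
    exact ⟨fun h => hadj.1 (Subtype.ext h.symm), hadj.2⟩
  · right
    rw [SimpleGraph.tutte] at h
    push Not at h
    obtain ⟨u, hu⟩ := h
    unfold IsTutteViolator at hu
    set H := ((⊤ : Γ.Subgraph).deleteVerts u) with hH
    let e : H.verts ↪ N := ⟨fun a => a.1.1, fun a b h => Subtype.ext (Subtype.ext h)⟩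
    let F : H.coe.ConnectedComponent → Finset N := fun c => c.supp.toFinset.map e
    have hmem : ∀ c n, n ∈ F c ↔ ∃ a : H.verts, H.coe.connectedComponentMk a = c ∧ a.1.1 = n := by
      intro c n
      simp only [F, mem_map, Set.mem_toFinset, ConnectedComponent.mem_supp_iff]
      rfl
    have huv : ∀ a : U, a ∈ H.verts ↔ a ∉ u := by intro a; simp [hH]
    have hFinj : ∀ c c' n, n ∈ F c → n ∈ F c' → c = c' := by
      intro c c' n h1 h2
      rw [hmem] at h1 h2
      obtain ⟨a, rfl, h1⟩ := h1
      obtain ⟨b, rfl, h2⟩ := h2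
      have : a = b := Subtype.ext (Subtype.ext (h1.trans h2.symm))
      rw [this]
    have hF : Function.Injective F := by
      intro c c' h
      obtain ⟨a, ha⟩ := c.exists_rep
      have h1 : a.1.1 ∈ F c := (hmem _ _).2 ⟨a, ha, rfl⟩
      exact hFinj _ _ _ h1 (h ▸ h1)
    refine ⟨u.toFinset.map (Function.Embedding.subtype _), ?_,
      (H.coe.oddComponents.toFinset).image F, ?_, ?_, ?_⟩
    · intro n hn
      simp only [mem_map, Set.mem_toFinset, Function.Embedding.subtype_apply] at hn
      obtain ⟨a, -, rfl⟩ := hn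
      exact a.2
    · rw [card_map, card_image_of_injective _ hF, ← Set.ncard_eq_toFinset_card',
        ← Set.ncard_eq_toFinset_card']
      exact hu
    · simp only [mem_image]
      rintro _ ⟨c, -, rfl⟩ _ ⟨c', -, rfl⟩ n h1 h2
      rw [hFinj _ _ _ h1 h2]
    · simp only [mem_image]
      rintro _ ⟨c, hc, rfl⟩
      refine ⟨?_, ?_, ?_⟩
      · rw [card_map, ← Set.ncard_eq_toFinset_card']
        simpa using hc
      · intro n hn
        obtain ⟨a, -, rfl⟩ := (hmem _ _).1 hn
        refine ⟨a.1.2, ?_⟩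
        have := (huv _).1 a.2
        simpa using this
      · intro n hn m hm hmu hrnm
        obtain ⟨a, hac, rfl⟩ := (hmem _ _).1 hn
        by_cases hnm : a.1.1 = m
        · rwa [← hnm]
        have hmu' : (⟨m, hm⟩ : U) ∉ u := by
          intro h
          exact hmu (by simpa using ⟨hm, h⟩)
        refine (hmem _ _).2 ⟨⟨⟨m, hm⟩, (huv _).2 hmu'⟩, ?_, rfl⟩
        rw [← hac]
        apply ConnectedComponent.sound
        apply Adj.reachable
        simp only [Subgraph.coe_adj, hH, Subgraph.deleteVerts_adj]
        have := (huv _).1 a.2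
        refine ⟨by simp, hmu', by simp, this, ?_⟩
        simp only [Subgraph.top_adj]
        exact ⟨fun h => hnm (congrArg Subtype.val h).symm, hr _ _ hrnm⟩

/-- The incidences `(x, v)` of a hypergraph whose hyperedge `x` has vertex set `I x`. -/
def ports {X V : Type*} [Fintype X] [Fintype V] [DecidableEq V] (I : X → Finset V) :
    Finset (X × V) :=
  {p | p.2 ∈ I p.1}

/-- A set of `w x` auxiliary nodes for each hyperedge `x`. -/
def dummies {X : Type*} [Fintype X] (w : X → ℕ) : Finset (X × ℕ) :=
  (univ ×ˢ range (univ.sup w)).filter fun d => d.2 < w d.1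

/-- Two ports are related if they share their hyperedge or their vertex; a port is related
to the dummies of its hyperedge. -/
def gadgetRel {X V : Type*} : (X × V) ⊕ (X × ℕ) → (X × V) ⊕ (X × ℕ) → Prop
  | .inl p, .inl q => p.1 = q.1 ∨ p.2 = q.2
  | .inl p, .inr d => p.1 = d.1
  | .inr d, .inl p => p.1 = d.1
  | .inr _, .inr _ => False

theorem gadgetRel_symm {X V : Type*} (a b : (X × V) ⊕ (X × ℕ)) (h : gadgetRel a b) :
    gadgetRel b a := by
  rcases a with a | a <;> rcases b with b | b <;> simp only [gadgetRel] at h ⊢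
  · exact h.imp Eq.symm Eq.symm
  · exact h
  · exact h

theorem mem_ports {X V : Type*} [Fintype X] [Fintype V] [DecidableEq V] {I : X → Finset V}
    {p : X × V} : p ∈ ports I ↔ p.2 ∈ I p.1 := by
  simp [ports]

theorem mem_dummies {X : Type*} [Fintype X] {w : X → ℕ} {d : X × ℕ} :
    d ∈ dummies w ↔ d.2 < w d.1 := by
  simp only [dummies, mem_filter, mem_product, mem_univ, true_and, mem_range, and_iff_right_iff_imp]
  exact fun h => h.trans_le (le_sup (mem_univ _))

theorem sum_ports_filter_fst {X V : Type*} [Fintype X] [Fintype V] [DecidableEq X] [DecidableEq V]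
    (I : X → Finset V) (Y : Finset X) (g : X → ℕ) :
    ∑ p ∈ ports I with p.1 ∈ Y, g p.1 = ∑ x ∈ Y, #(I x) * g x := by
  rw [sum_finset_product _ Y I fun p => by simp [mem_ports, and_comm]]
  simp

theorem sum_ports_filter_snd {X V : Type*} [Fintype X] [Fintype V] [DecidableEq X] [DecidableEq V]
    (I : X → Finset V) (Z : Finset V) (g : X → ℕ) :
    ∑ p ∈ ports I with p.2 ∈ Z, g p.1 = ∑ v ∈ Z, ∑ x with v ∈ I x, g x := by
  rw [sum_finset_product_right _ Z (fun v => univ.filter fun x => v ∈ I x)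
    fun p => by simp [mem_ports, and_comm]]

theorem card_dummies_filter {X : Type*} [Fintype X] [DecidableEq X] (w : X → ℕ) (Y : Finset X) :
    #{d ∈ dummies w | d.1 ∈ Y} = ∑ x ∈ Y, w x := by
  rw [card_eq_sum_ones, sum_finset_product _ Y (fun x => range (w x))
    fun d => by simp [mem_dummies, and_comm]]
  simp

/-- The nodes of the gadget graph. -/
abbrev gadgetNodes {X V : Type*} [Fintype X] [Fintype V] [DecidableEq V]
    (I : X → Finset V) (w : X → ℕ) : Finset ((X × V) ⊕ (X × ℕ)) :=
  (ports I).disjSum (dummies w)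

/-- The hyperedges having a node in `K`. -/
def edgesOf {X V : Type*} [DecidableEq X] (K : Finset ((X × V) ⊕ (X × ℕ))) : Finset X :=
  K.image (Sum.elim Prod.fst Prod.fst)

/-- The vertices having a port in `K`. -/
def vertsOf {X V : Type*} [DecidableEq V] (K : Finset ((X × V) ⊕ (X × ℕ))) : Finset V :=
  K.toLeft.image Prod.snd

theorem sum_add_sum_filter_mem {α : Type*} [DecidableEq α] {P K S : Finset α} {p : α → Prop}
    [DecidablePred p] (hKS : ∀ a ∈ K, a ∉ S) (hS : S ⊆ P)
    (h : ∀ a, a ∈ K ↔ a ∈ P ∧ a ∉ S ∧ p a) (g : α → ℕ) :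
    ∑ a ∈ K, g a + ∑ a ∈ S with p a, g a = ∑ a ∈ P with p a, g a := by
  rw [← sum_union]
  · apply sum_congr _ fun _ _ => rfl
    ext a
    have := @hS a
    simp only [mem_union, mem_filter, h]
    tauto
  · exact disjoint_left.2 fun a ha hb => hKS a ha (mem_filter.1 hb).1

/-- The amount (in sixths) that the component `K` of the gadget graph minus `S` receives when
every node of `S` distributes one unit among the components next to it. -/
def charge {X V : Type*} [DecidableEq X] [DecidableEq V] (w : X → ℕ)
    (S K : Finset ((X × V) ⊕ (X × ℕ))) : ℕ :=
  ∑ p ∈ S.toLeft with p.2 ∈ vertsOf K, (4 - w p.1) +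
    ∑ p ∈ S.toLeft with p.1 ∈ edgesOf K, (2 + w p.1) + 6 * #{d ∈ S.toRight | d.1 ∈ edgesOf K}

/-- Vertex sets `I x` of the hyperedges and weights `w x`, modelled on the odd cycles (of weight
2) and the remaining edges (of weight 1) of a 2-connected graph with degrees divisible by 4. -/
structure IsCycleSystem {X V : Type*} [Fintype X] [DecidableEq V]
    (I : X → Finset V) (w : X → ℕ) : Prop where
  size : ∀ x, (w x = 1 ∧ #(I x) = 2) ∨ (w x = 2 ∧ Odd #(I x) ∧ 3 ≤ #(I x))
  four_dvd : ∀ v, 4 ∣ ∑ x with v ∈ I x, w x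
  no_cut : ∀ (v : V) (A : Finset V), (∃ y ∈ A, y ≠ v) → (∃ z, z ∉ A) → v ∈ A →
    ∃ x, ∃ y ∈ I x, ∃ z ∈ I x, y ∈ A ∧ y ≠ v ∧ z ∉ A

/-- The components of the gadget graph minus `S`, other than isolated dummies. -/
structure IsProperComponent {X V : Type*} [Fintype X] [Fintype V] [DecidableEq V]
    (I : X → Finset V) (w : X → ℕ) (S K : Finset ((X × V) ⊕ (X × ℕ))) : Prop where
  subset : ∀ n ∈ K, n ∈ gadgetNodes I w ∧ n ∉ S
  closed : ∀ n ∈ K, ∀ m ∈ gadgetNodes I w, m ∉ S → gadgetRel n m → m ∈ K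
  exists_port : ∀ d, Sum.inr d ∈ K → ∃ v ∈ I d.1, Sum.inl (d.1, v) ∉ S

namespace IsProperComponent

variable {X V : Type*} [Fintype X] [Fintype V] [DecidableEq V]
  {I : X → Finset V} {w : X → ℕ} {S K : Finset ((X × V) ⊕ (X × ℕ))}

theorem exists_port_of_mem_edgesOf [DecidableEq X] (hK : IsProperComponent I w S K) {x : X}
    (hx : x ∈ edgesOf K) : ∃ v ∈ I x, Sum.inl (x, v) ∉ S ∧ Sum.inl (x, v) ∈ K := by
  obtain ⟨n, hn, rfl⟩ := mem_image.1 hx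
  rcases n with ⟨x, v⟩ | d
  · have := hK.subset _ hn
    simp only [inl_mem_disjSum, mem_ports] at this
    exact ⟨v, this.1, this.2, hn⟩
  · obtain ⟨v, hv, hvS⟩ := hK.exists_port d hn
    refine ⟨v, hv, hvS, hK.closed _ hn _ ?_ hvS ?_⟩
    · simpa [mem_ports] using hv
    · simp [gadgetRel]

theorem inl_mem_iff_fst [DecidableEq X] (hK : IsProperComponent I w S K) (p : X × V) :
    Sum.inl p ∈ K ↔ p ∈ ports I ∧ Sum.inl p ∉ S ∧ p.1 ∈ edgesOf K := by
  constructor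
  · intro h
    have := hK.subset _ h
    exact ⟨inl_mem_disjSum.1 this.1, this.2, mem_image.2 ⟨_, h, rfl⟩⟩
  · rintro ⟨hp, hpS, hx⟩
    obtain ⟨v, -, -, hvK⟩ := hK.exists_port_of_mem_edgesOf hx
    exact hK.closed _ hvK _ (inl_mem_disjSum.2 hp) hpS (Or.inl rfl)

theorem inl_mem_iff_snd (hK : IsProperComponent I w S K) (p : X × V) :
    Sum.inl p ∈ K ↔ p ∈ ports I ∧ Sum.inl p ∉ S ∧ p.2 ∈ vertsOf K := by
  constructor
  · intro h
    have := hK.subset _ h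
    exact ⟨inl_mem_disjSum.1 this.1, this.2, mem_image.2 ⟨p, mem_toLeft.2 h, rfl⟩⟩
  · rintro ⟨hp, hpS, hx⟩
    obtain ⟨q, hq, hqp⟩ := mem_image.1 hx
    exact hK.closed _ (mem_toLeft.1 hq) _ (inl_mem_disjSum.2 hp) hpS (Or.inr hqp)

theorem inr_mem_iff [DecidableEq X] (hK : IsProperComponent I w S K) (d : X × ℕ) :
    Sum.inr d ∈ K ↔ d ∈ dummies w ∧ Sum.inr d ∉ S ∧ d.1 ∈ edgesOf K := by
  constructor
  · intro h
    have := hK.subset _ h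
    exact ⟨inr_mem_disjSum.1 this.1, this.2, mem_image.2 ⟨_, h, rfl⟩⟩
  · rintro ⟨hp, hpS, hx⟩
    obtain ⟨v, -, -, hvK⟩ := hK.exists_port_of_mem_edgesOf hx
    exact hK.closed _ hvK _ (inr_mem_disjSum.2 hp) hpS rfl

/-- An odd component receives at least one unit, unless it touches `S` only in a single port of
a cycle outside the component; the latter is excluded since there is no cut vertex. -/
theorem six_le_charge [DecidableEq X] (h : IsCycleSystem I w) (hS : S ⊆ gadgetNodes I w)
    (hK : IsProperComponent I w S K) (hodd : Odd #K) : 6 ≤ charge w S K := by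
  by_contra! hlt
  have hw : ∀ x, 1 ≤ w x ∧ w x ≤ 2 := fun x => by have := h.size x; omega
  have hSl : S.toLeft ⊆ ports I := fun p hp => inl_mem_disjSum.1 (hS (mem_toLeft.1 hp))
  have hSr : S.toRight ⊆ dummies w := fun p hp => inr_mem_disjSum.1 (hS (mem_toRight.1 hp))
  have hdl : ∀ p ∈ K.toLeft, p ∉ S.toLeft := fun p hp => by
    simpa using (hK.subset _ (mem_toLeft.1 hp)).2
  have hdr : ∀ p ∈ K.toRight, p ∉ S.toRight := fun p hp => by
    simpa using (hK.subset _ (mem_toRight.1 hp)).2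
  have hfst := sum_add_sum_filter_mem hdl hSl (p := fun p => p.1 ∈ edgesOf K)
    (fun p => by simpa using hK.inl_mem_iff_fst p)
  have hsnd := sum_add_sum_filter_mem hdl hSl (p := fun p => p.2 ∈ vertsOf K)
    (fun p => by simpa using hK.inl_mem_iff_snd p)
  have hdum := sum_add_sum_filter_mem hdr hSr (p := fun p => p.1 ∈ edgesOf K)
    (fun p => by simpa using hK.inr_mem_iff p) (fun _ => 1)
  have h1 := hfst (fun p => 1)
  have h2 := hfst (fun p => w p.1)
  have h3 := hsnd (fun p => w p.1)
  rw [sum_ports_filter_fst I _ fun _ => 1] at h1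
  rw [sum_ports_filter_fst] at h2
  rw [sum_ports_filter_snd] at h3
  simp only [← card_eq_sum_ones, mul_one] at h1 hdum
  rw [card_dummies_filter] at hdum
  have hcard := K.card_toLeft_add_card_toRight
  have hd4 : 4 ∣ ∑ v ∈ vertsOf K, ∑ x with v ∈ I x, w x := dvd_sum fun v _ => h.four_dvd v
  have hm4 : (∑ x ∈ edgesOf K, #(I x) * w x) % 4 = (∑ x ∈ edgesOf K, 2) % 4 := by
    rw [sum_nat_mod, sum_nat_mod (edgesOf K) _ fun _ => 2]
    refine congrArg (· % 4) (sum_congr rfl fun x _ => ?_)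
    obtain ⟨h1, h2⟩ | ⟨h1, ⟨k, hk⟩, -⟩ := h.size x
    · rw [h1, h2]
    · rw [h1, hk]; omega
  have hm2 : (∑ x ∈ edgesOf K, (#(I x) + w x)) % 2 = (∑ x ∈ edgesOf K, 1) % 2 := by
    rw [sum_nat_mod, sum_nat_mod (edgesOf K) _ fun _ => 1]
    refine congrArg (· % 2) (sum_congr rfl fun x _ => ?_)
    obtain ⟨h1, h2⟩ | ⟨h1, ⟨k, hk⟩, -⟩ := h.size x <;> omega
  simp only [sum_const, smul_eq_mul, mul_one, sum_add_distrib] at hm4 hm2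
  unfold charge at hlt
  set a := S.toLeft.filter fun p => p.2 ∈ vertsOf K with ha
  set b := S.toLeft.filter fun p => p.1 ∈ edgesOf K with hb
  have ha4 : ∑ p ∈ a, (4 - w p.1) + ∑ p ∈ a, w p.1 = 4 * #a := by
    rw [← sum_add_distrib, sum_congr rfl fun p _ => Nat.sub_add_cancel (by have := hw p.1; omega)]
    simp [mul_comm]
  have hb2 : ∑ p ∈ b, (2 + w p.1) = 2 * #b + ∑ p ∈ b, w p.1 := by
    rw [sum_add_distrib]; simp [mul_comm]
  have hwl : ∀ s : Finset (X × V), #s ≤ ∑ p ∈ s, w p.1 := fun s => by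
    rw [card_eq_sum_ones]; exact sum_le_sum fun p _ => (hw p.1).1
  have hwu : ∀ s : Finset (X × V), ∑ p ∈ s, w p.1 ≤ 2 * #s := fun s => by
    rw [mul_comm, ← smul_eq_mul, ← sum_const]; exact sum_le_sum fun p _ => (hw p.1).2
  have e1 := hwl a
  have e2 := hwu a
  have e3 := hwl b
  have e4 := hwu b
  rw [Nat.odd_iff] at hodd
  have hfin : #a = 1 ∧ ∑ p ∈ a, w p.1 = 2 ∧ #b = 0 ∧ #{d ∈ S.toRight | d.1 ∈ edgesOf K} = 0 := by
    omega
  obtain ⟨ha1, hwa, hb0, hd0⟩ := hfin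
  obtain ⟨⟨x₀, v₀⟩, ha1⟩ := card_eq_one.1 ha1
  rw [card_eq_zero] at hb0
  rw [ha1, sum_singleton] at hwa
  simp only at hwa
  have hva : ∀ x v, Sum.inl (x, v) ∈ S → v ∈ vertsOf K → x = x₀ ∧ v = v₀ := by
    intro x v hS hv
    have : (x, v) ∈ a := mem_filter.2 ⟨mem_toLeft.2 hS, hv⟩
    simpa [ha1] using this
  have hxb : ∀ x v, Sum.inl (x, v) ∈ S → x ∉ edgesOf K := by
    intro x v hS hx
    have : (x, v) ∈ b := mem_filter.2 ⟨mem_toLeft.2 hS, hx⟩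
    simp [hb0] at this
  have h0 : (x₀, v₀) ∈ a := by simp [ha1]
  obtain ⟨h0S, h0v⟩ := mem_filter.1 h0
  rw [mem_toLeft] at h0S
  have hx0 : x₀ ∉ edgesOf K := hxb _ _ h0S
  have hvx : ∀ x v, v ∈ vertsOf K → v ∈ I x → x ≠ x₀ ∨ v ≠ v₀ → x ∈ edgesOf K := by
    intro x v hv hvx hne
    have : Sum.inl (x, v) ∈ K := (hK.inl_mem_iff_snd _).2
      ⟨mem_ports.2 hvx, fun hS => by have := hva _ _ hS hv; tauto, hv⟩
    exact ((hK.inl_mem_iff_fst _).1 this).2.2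
  have hxv : ∀ x v, x ∈ edgesOf K → v ∈ I x → v ∈ vertsOf K := by
    intro x v hx hvx
    have : Sum.inl (x, v) ∈ K := (hK.inl_mem_iff_fst _).2
      ⟨mem_ports.2 hvx, fun hS => hxb _ _ hS hx, hx⟩
    exact ((hK.inl_mem_iff_snd _).1 this).2.2
  obtain ⟨n, hn⟩ : K.Nonempty := card_pos.1 (by omega)
  have hx1 : Sum.elim Prod.fst Prod.fst n ∈ edgesOf K := mem_image_of_mem _ hn
  set x₁ := Sum.elim Prod.fst Prod.fst n
  obtain ⟨y, hy, hyv⟩ := exists_mem_ne (s := I x₁) (by have := h.size x₁; omega) v₀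
  obtain ⟨z, hz, hzv⟩ := exists_mem_ne (s := I x₀) (by have := h.size x₀; omega) v₀
  obtain ⟨x, y', hy', z', hz', hyA, hyne, hzA⟩ := h.no_cut v₀ (vertsOf K)
    ⟨y, hxv _ _ hx1 hy, hyv⟩ ⟨z, fun hzA => hx0 (hvx _ _ hzA hz (Or.inr hzv))⟩ h0v
  exact hzA (hxv _ _ (hvx _ _ hyA hy' (Or.inr hyne)) hz')

end IsProperComponent

theorem sum_sum_filter_le {α β : Type*} (T : Finset α) (s : Finset β) (R : α → β → Prop)
    (Q : β → Prop) [∀ a, DecidablePred (R a)] [DecidablePred Q]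
    (huniq : ∀ b, ∀ a ∈ T, ∀ a' ∈ T, R a b → R a' b → a = a')
    (hQ : ∀ b, ∀ a ∈ T, R a b → Q b) (g : β → ℕ) :
    ∑ a ∈ T, ∑ b ∈ s with R a b, g b ≤ ∑ b ∈ s with Q b, g b := by
  simp_rw [sum_filter]
  rw [sum_comm]
  refine sum_le_sum fun b _ => ?_
  by_cases h : ∃ a ∈ T, R a b
  · obtain ⟨a, ha, hab⟩ := h
    rw [sum_eq_single_of_mem a ha fun a' ha' hne =>
      if_neg fun h' => hne (huniq b a' ha' a ha h' hab), if_pos hab, if_pos (hQ b a ha hab)]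
  · push Not at h
    rw [sum_eq_zero fun a ha => if_neg (h a ha)]
    exact Nat.zero_le _

theorem card_components_le {X V : Type*} [Fintype X] [Fintype V] [DecidableEq X] [DecidableEq V]
    {I : X → Finset V} {w : X → ℕ} (h : IsCycleSystem I w)
    {S : Finset ((X × V) ⊕ (X × ℕ))} (hS : S ⊆ gadgetNodes I w)
    {𝒦 : Finset (Finset ((X × V) ⊕ (X × ℕ)))}
    (hdisj : ∀ K ∈ 𝒦, ∀ L ∈ 𝒦, ∀ n ∈ K, n ∈ L → K = L)
    (h𝒦 : ∀ K ∈ 𝒦, Odd #K ∧ (∀ n ∈ K, n ∈ gadgetNodes I w ∧ n ∉ S) ∧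
      ∀ n ∈ K, ∀ m ∈ gadgetNodes I w, m ∉ S → gadgetRel n m → m ∈ K) : #𝒦 ≤ #S := by
  classical
  let F : Finset X := {x | ∀ v ∈ I x, Sum.inl (x, v) ∈ S}
  have hF : ∀ x, x ∈ F ↔ ∀ v ∈ I x, Sum.inl (x, v) ∈ S := fun x => by simp [F]
  let P : Finset ((X × V) ⊕ (X × ℕ)) → Prop := fun K => ∃ d, Sum.inr d ∈ K ∧ d.1 ∈ F
  have hsplit : #{K ∈ 𝒦 | P K} + #{K ∈ 𝒦 | ¬ P K} = #𝒦 := by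
    convert card_filter_add_card_filter_not (s := 𝒦) P
  have hisolated : #{K ∈ 𝒦 | P K} ≤ ∑ x ∈ F, w x := by
    rw [← card_dummies_filter]
    refine card_le_card_of_forall_subsingleton (fun K d => Sum.inr d ∈ K) ?_ ?_
    · intro K hK
      obtain ⟨hK, d, hd, hdF⟩ := mem_filter.1 hK
      exact ⟨d, mem_filter.2 ⟨inr_mem_disjSum.1 ((h𝒦 K hK).2.1 _ hd).1, hdF⟩, hd⟩
    · rintro d - K ⟨hK, hdK⟩ L ⟨hL, hdL⟩
      exact hdisj K (mem_filter.1 hK).1 L (mem_filter.1 hL).1 _ hdK hdL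
  have hproper : ∀ K ∈ 𝒦.filter fun K => ¬ P K, K ∈ 𝒦 ∧ IsProperComponent I w S K := by
    intro K hK
    obtain ⟨hK, hPK⟩ := mem_filter.1 hK
    refine ⟨hK, ⟨(h𝒦 K hK).2.1, (h𝒦 K hK).2.2, fun d hd => ?_⟩⟩
    by_contra! hcon
    exact hPK ⟨d, hd, (hF _).2 hcon⟩
  set 𝒦' := 𝒦.filter fun K => ¬ P K
  have hcharge : 6 * #𝒦' ≤ ∑ K ∈ 𝒦', charge w S K := by
    rw [mul_comm, ← smul_eq_mul, ← sum_const]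
    exact sum_le_sum fun K hK =>
      (hproper K hK).2.six_le_charge h hS (h𝒦 K (hproper K hK).1).1
  have huniq : ∀ x, ∀ K ∈ 𝒦', ∀ L ∈ 𝒦', x ∈ edgesOf K → x ∈ edgesOf L → K = L := by
    intro x K hK L hL hxK hxL
    obtain ⟨v, hv, hvS, hvK⟩ := (hproper K hK).2.exists_port_of_mem_edgesOf hxK
    exact hdisj K (hproper K hK).1 L (hproper L hL).1 _ hvK
      (((hproper L hL).2.inl_mem_iff_fst _).2 ⟨mem_ports.2 hv, hvS, hxL⟩)
  have hnotF : ∀ x, ∀ K ∈ 𝒦', x ∈ edgesOf K → x ∉ F := by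
    intro x K hK hx hxF
    obtain ⟨v, hv, hvS, -⟩ := (hproper K hK).2.exists_port_of_mem_edgesOf hx
    exact hvS ((hF x).1 hxF v hv)
  have hverts := sum_sum_filter_le 𝒦' S.toLeft (fun K p => p.2 ∈ vertsOf K) (fun _ => True)
    (fun p K hK L hL hpK hpL => by
      obtain ⟨q, hq, hqp⟩ := mem_image.1 hpK
      have hqK := mem_toLeft.1 hq
      have := ((hproper K hK).2.inl_mem_iff_snd _).1 hqK
      exact hdisj K (hproper K hK).1 L (hproper L hL).1 _ hqK
        (((hproper L hL).2.inl_mem_iff_snd _).2 ⟨this.1, this.2.1, hqp ▸ hpL⟩))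
    (fun _ _ _ _ => trivial) (fun p => 4 - w p.1)
  have hedges := sum_sum_filter_le 𝒦' S.toLeft (fun K p => p.1 ∈ edgesOf K) (fun p => p.1 ∉ F)
    (fun p => huniq p.1) (fun p => hnotF p.1) (fun p => 2 + w p.1)
  have hdums := sum_sum_filter_le 𝒦' S.toRight (fun K d => d.1 ∈ edgesOf K) (fun d => d.1 ∉ F)
    (fun p => huniq p.1) (fun p => hnotF p.1) (fun _ => 1)
  simp only [← card_eq_sum_ones] at hdums
  simp only [charge, sum_add_distrib (s := 𝒦'), ← mul_sum] at hcharge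
  have hdumS := card_filter_le S.toRight fun d => d.1 ∉ F
  have hSl : ∑ p ∈ S.toLeft, (4 - w p.1) + ∑ p ∈ S.toLeft, (2 + w p.1) = 6 * #S.toLeft := by
    rw [← sum_add_distrib, sum_congr rfl fun p _ => (by have := h.size p.1; omega :
      4 - w p.1 + (2 + w p.1) = 6)]
    simp [mul_comm]
  have hSF := sum_filter_add_sum_filter_not S.toLeft (fun p => p.1 ∈ F) fun p => 2 + w p.1
  have hfull : ∑ p ∈ S.toLeft with p.1 ∈ F, (2 + w p.1) = ∑ x ∈ F, #(I x) * (2 + w x) := by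
    rw [← sum_ports_filter_fst]
    refine sum_congr ?_ fun _ _ => rfl
    ext p
    simp only [mem_filter, mem_toLeft]
    exact and_congr_left fun hp => ⟨fun hpS => inl_mem_disjSum.1 (hS hpS),
      fun hpI => (hF _).1 hp _ (mem_ports.1 hpI)⟩
  have hfull' : 6 * ∑ x ∈ F, w x ≤ ∑ x ∈ F, #(I x) * (2 + w x) := by
    rw [mul_sum]
    refine sum_le_sum fun x _ => ?_
    obtain ⟨h1, h2⟩ | ⟨h1, -, h3⟩ := h.size x
    · rw [h1, h2]; norm_num
    · rw [h1]; omega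
  have hcard := S.card_toLeft_add_card_toRight
  rw [filter_true_of_mem fun _ _ => trivial] at hverts
  omega

/-- In a cycle system one can choose an odd subset of every hyperedge, proper for those of
weight 2, such that every vertex is chosen an even number of times. -/
theorem IsCycleSystem.exists_odd_subsets {X V : Type*} [Fintype X] [Fintype V]
    [DecidableEq V] {I : X → Finset V} {w : X → ℕ} (h : IsCycleSystem I w) :
    ∃ T : X → Finset V, (∀ x, T x ⊆ I x ∧ Odd #(T x) ∧ T x ≠ I x) ∧
      ∀ v, Even #{x | v ∈ T x} := by
  classical
  obtain ⟨f, hf⟩ | ⟨S, hS, 𝒦, hlt, hdisj, h𝒦⟩ :=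
    exists_pairing_or_barrier (gadgetNodes I w) gadgetRel gadgetRel_symm
  swap
  · exact absurd (card_components_le h hS hdisj h𝒦) hlt.not_ge
  have hport : ∀ {x v}, v ∈ I x → Sum.inl (x, v) ∈ gadgetNodes I w := fun hv =>
    inl_mem_disjSum.2 (mem_ports.2 hv)
  have hdummy : ∀ {x i}, i < w x → Sum.inr (x, i) ∈ gadgetNodes I w := fun hi =>
    inr_mem_disjSum.2 (mem_dummies.2 hi)
  let lab : (X × V) ⊕ (X × ℕ) → X := Sum.elim Prod.fst Prod.fst
  let T : X → Finset V := fun x => {v ∈ I x | lab (f (.inl (x, v))) ≠ x}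
  have hT : ∀ x v, v ∈ T x ↔ v ∈ I x ∧ lab (f (.inl (x, v))) ≠ x := fun x v => by simp [T]
  have hpartner : ∀ x v, v ∈ T x →
      ∃ y, f (.inl (x, v)) = .inl (y, v) ∧ y ≠ x ∧ v ∈ T y := by
    intro x v hv
    obtain ⟨hvI, hne⟩ := (hT _ _).1 hv
    obtain ⟨h1, h2, h3, h4⟩ := hf _ (hport hvI)
    rcases hfx : f (.inl (x, v)) with ⟨y, u⟩ | d
    · rw [hfx] at h1 h3 h4 hne
      simp only [gadgetRel, lab, Sum.elim_inl] at h3 hne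
      obtain rfl : v = u := h3.resolve_left (Ne.symm hne)
      refine ⟨y, rfl, hne, (hT _ _).2 ⟨mem_ports.1 (inl_mem_disjSum.1 h1), ?_⟩⟩
      rw [h4]
      exact Ne.symm hne
    · rw [hfx] at h3 hne
      exact absurd h3.symm hne
  have hTI : ∀ x, T x ⊆ I x := fun x => filter_subset _ _
  refine ⟨T, fun x => ⟨hTI x, ?_, ?_⟩, fun v => ?_⟩
  · let A : Finset ((X × V) ⊕ (X × ℕ)) :=
      {n ∈ gadgetNodes I w | lab n = x ∧ lab (f n) = x}
    have hA : Even #A := by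
      refine even_card_of_involution A f ?_ ?_ ?_ <;> intro n hn <;>
        obtain ⟨hn, h1, h2⟩ := mem_filter.1 hn <;> obtain ⟨h3, h4, h5, h6⟩ := hf n hn
      · exact mem_filter.2 ⟨h3, h2, by rw [h6]; exact h1⟩
      · exact h4
      · exact h6
    have hA' : A = ((I x \ T x).map ⟨Prod.mk x, Prod.mk_right_injective x⟩).disjSum
        ((range (w x)).map ⟨Prod.mk x, Prod.mk_right_injective x⟩) := by
      ext n
      rcases n with ⟨y, v⟩ | ⟨y, i⟩
      · simp only [A, mem_filter, inl_mem_disjSum, mem_ports, lab, Sum.elim_inl, mem_map, mem_sdiff,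
          hT, Function.Embedding.coeFn_mk, Prod.mk.injEq]
        constructor
        · rintro ⟨hv, rfl, hl⟩
          exact ⟨v, ⟨hv, fun h => h.2 hl⟩, rfl, rfl⟩
        · rintro ⟨u, ⟨hu, hl⟩, rfl, rfl⟩
          exact ⟨hu, rfl, by_contra fun h => hl ⟨hu, h⟩⟩
      · simp only [A, mem_filter, inr_mem_disjSum, mem_dummies, lab, Sum.elim_inr, mem_map,
          mem_range, Function.Embedding.coeFn_mk, Prod.mk.injEq]
        constructor
        · rintro ⟨hi, rfl, -⟩
          exact ⟨i, hi, rfl, rfl⟩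
        · rintro ⟨j, hj, rfl, rfl⟩
          refine ⟨hj, rfl, ?_⟩
          have := (hf _ (hdummy hj)).2.2.1
          rcases hfx : f (.inr (x, j)) with q | d <;> rw [hfx] at this
          · exact this
          · exact this.elim
    rw [hA', card_disjSum, card_map, card_map, card_range,
      card_sdiff_of_subset (hTI x)] at hA
    have hle : #(T x) ≤ #(I x) := card_le_card (hTI x)
    have := h.size x
    simp only [Nat.odd_iff, Nat.even_iff] at *
    omega
  · intro hTeq
    have hw : 0 < w x := by have := h.size x; omega
    obtain ⟨h1, -, h3, h4⟩ := hf _ (hdummy hw)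
    rcases hfx : f (.inr (x, 0)) with ⟨y, v⟩ | d <;> rw [hfx] at h1 h3 h4
    · obtain rfl : y = x := h3
      have hv : v ∈ T y := hTeq ▸ mem_ports.1 (inl_mem_disjSum.1 h1)
      exact ((hT _ _).1 hv).2 (by rw [h4]; rfl)
    · exact h3
  · refine even_card_of_involution _ (fun x => lab (f (.inl (x, v)))) ?_ ?_ ?_ <;> intro x hx <;>
      simp only [mem_filter, mem_univ, true_and] at hx ⊢ <;>
      obtain ⟨y, hy, hne, hvy⟩ := hpartner x v hx
    · rw [hy]; exact hvy
    · rw [hy]; exact hne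
    · have := (hf _ (hport ((hT _ _).1 hx).1)).2.2.2
      rw [hy] at this ⊢
      simp only [lab, Sum.elim_inl, this]

section Orientation

variable [Fintype V] {H : SimpleGraph V}

theorem sum_indeg (D : Orient H) : ∑ v, indeg D v = H.edgeSet.ncard := by
  classical
  have h : ∀ v, indeg D v = #{u | D.dir u v} := fun v => by
    rw [indeg, Set.ncard_eq_toFinset_card']
    simp
  simp_rw [h, ← card_sigma]
  rw [Set.ncard_eq_toFinset_card']
  refine card_bij (fun p _ => s(p.2, p.1)) ?_ ?_ ?_
  · rintro ⟨v, u⟩ h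
    simp only [mem_sigma, mem_filter, mem_univ, true_and] at h
    simpa using (D.adj_iff u v).2 (Or.inl h)
  · rintro ⟨v, u⟩ h ⟨v', u'⟩ h' heq
    simp only [mem_sigma, mem_filter, mem_univ, true_and] at h h'
    rcases Sym2.eq_iff.1 heq with ⟨h1, h2⟩ | ⟨h1, h2⟩
    · simp only at h1 h2
      rw [h1, h2]
    · simp only at h1 h2
      subst h1 h2
      exact absurd h' (D.asymm _ _ h)
  · intro e
    induction e with | _ u v
    intro he
    simp only [Set.mem_toFinset, mem_edgeSet] at he
    rcases (D.adj_iff u v).1 he with h | h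
    · exact ⟨⟨v, u⟩, by simpa using h, rfl⟩
    · exact ⟨⟨u, v⟩, by simpa using h, Sym2.eq_swap⟩

theorem exists_orient (H : SimpleGraph V) : Nonempty (Orient H) := by
  let e := Fintype.equivFin V
  refine ⟨⟨fun u v => H.Adj u v ∧ e u < e v, fun u v => ⟨fun h => ?_, ?_⟩, fun u v h h' => ?_⟩⟩
  · rcases lt_or_gt_of_ne (e.injective.ne h.ne) with hlt | hlt
    · exact Or.inl ⟨h, hlt⟩
    · exact Or.inr ⟨h.symm, hlt⟩
  · rintro (h | h)
    · exact h.1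
    · exact h.1.symm
  · exact lt_asymm h.2 h'.2

theorem exists_reverse_edge [DecidableEq V] (D : Orient H) {a b : V} (hab : D.dir a b) :
    ∃ D' : Orient H, ∀ v, (indeg D' v : ZMod 2) =
      indeg D v + ((Pi.single a 1 : V → ZMod 2) v + (Pi.single b 1 : V → ZMod 2) v) := by
  have hba := D.asymm a b hab
  have hne : a ≠ b := fun h => ((D.adj_iff a b).2 (Or.inl hab)).ne h
  let D' : Orient H :=
    { dir := fun u v => (D.dir u v ∧ ¬ (u = a ∧ v = b)) ∨ (u = b ∧ v = a)
      adj_iff := fun u v => by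
        rw [D.adj_iff]
        by_cases h1 : u = a ∧ v = b
        · obtain ⟨rfl, rfl⟩ := h1; tauto
        · by_cases h2 : v = a ∧ u = b
          · obtain ⟨rfl, rfl⟩ := h2; tauto
          · tauto
      asymm := fun u v h h' => by
        have := D.asymm u v
        rcases h with h | ⟨rfl, rfl⟩ <;> rcases h' with h' | ⟨h1, h2⟩
        · exact this h.1 h'.1
        · exact h.2 ⟨h2, h1⟩
        · exact h'.2 ⟨rfl, rfl⟩
        · exact hne h1 }
  refine ⟨D', fun v => ?_⟩
  by_cases hva : v = a
  · subst hva
    have : {u | D'.dir u v} = insert b {u | D.dir u v} := by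
      ext u
      simp [D', hne, or_comm]
    rw [indeg, this, Set.ncard_insert_of_notMem (s := {u | D.dir u v}) (by simpa using hba), indeg]
    simp [hne]
  · by_cases hvb : v = b
    · subst hvb
      have : {u | D.dir u v} = insert a {u | D'.dir u v} := by
        ext u
        simp only [D', Set.mem_ofPred_eq, Set.mem_insert_iff]
        by_cases hu : u = a
        · subst hu; simp [hab]
        · simp [hu, hva]
      have hmem : a ∉ {u | D'.dir u v} := by simp [D', hva]
      conv_rhs => rw [indeg, this, Set.ncard_insert_of_notMem hmem]
      simp only [indeg, Pi.single_eq_same, Pi.single_eq_of_ne hva, Nat.cast_add, Nat.cast_one,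
        zero_add, add_assoc, CharTwo.add_self_eq_zero, add_zero]
    · have : {u | D'.dir u v} = {u | D.dir u v} := by
        ext u
        simp [D', hva, hvb]
      simp [indeg, this, hva, hvb]

theorem exists_reverse_path [DecidableEq V] (D : Orient H) {a b : V} (hab : H.Reachable a b) :
    ∃ D' : Orient H, ∀ v, (indeg D' v : ZMod 2) =
      indeg D v + ((Pi.single a 1 : V → ZMod 2) v + (Pi.single b 1 : V → ZMod 2) v) := by
  obtain ⟨p⟩ := hab
  induction p with
  | nil => exact ⟨D, fun v => by rw [CharTwo.add_self_eq_zero, add_zero]⟩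
  | @cons a c b hac p ih =>
    obtain ⟨D₁, h₁⟩ := ih
    obtain ⟨D₂, h₂⟩ : ∃ D' : Orient H, ∀ v, (indeg D' v : ZMod 2) =
        indeg D₁ v + ((Pi.single a 1 : V → ZMod 2) v + (Pi.single c 1 : V → ZMod 2) v) := by
      rcases (D₁.adj_iff a c).1 hac with h | h
      · exact exists_reverse_edge D₁ h
      · obtain ⟨D', h'⟩ := exists_reverse_edge D₁ h
        exact ⟨D', fun v => by rw [h', add_comm ((Pi.single c 1 : V → ZMod 2) v)]⟩
    refine ⟨D₂, fun v => ?_⟩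
    rw [h₂, h₁]
    linear_combination CharTwo.add_self_eq_zero ((Pi.single c 1 : V → ZMod 2) v)

/-- Indegree parities may be prescribed on a connected part, up to the parity of their sum. -/
theorem exists_orient_of_parity (D : Orient H) (p : V → ZMod 2)
    (hsum : ∑ v, (indeg D v : ZMod 2) = ∑ v, p v)
    (hreach : ∀ a b, (indeg D a : ZMod 2) ≠ p a → (indeg D b : ZMod 2) ≠ p b → H.Reachable a b) :
    ∃ D' : Orient H, ∀ v, (indeg D' v : ZMod 2) = p v := by
  classical
  induction hn : #{v | (indeg D v : ZMod 2) ≠ p v} using Nat.strong_induction_on generalizing D with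
  | _ n ih =>
  by_cases hall : ∀ v, (indeg D v : ZMod 2) = p v
  · exact ⟨D, hall⟩
  push Not at hall
  obtain ⟨a, ha⟩ := hall
  obtain ⟨b, hb, hba⟩ : ∃ b, (indeg D b : ZMod 2) ≠ p b ∧ b ≠ a := by
    by_contra! hcon
    refine ha (sub_eq_zero.1 ?_)
    rw [← sum_eq_single (s := univ) (f := fun v => (indeg D v : ZMod 2) - p v) a
      (fun v _ hv => sub_eq_zero.2 (by_contra fun h => hv (hcon v h))) (by simp),
      sum_sub_distrib, hsum, sub_self]
  obtain ⟨D', hD'⟩ := exists_reverse_path D (hreach a b ha hb)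
  have hflip : ∀ x y : ZMod 2, x ≠ y → x + 1 = y := by decide
  have hsub : ∀ v, (indeg D' v : ZMod 2) ≠ p v →
      (indeg D v : ZMod 2) ≠ p v ∧ v ≠ a := by
    intro v hv
    rw [hD'] at hv
    by_cases hva : v = a
    · subst hva
      exact absurd (hflip _ _ ha) (by simpa [hba.symm] using hv)
    · by_cases hvb : v = b
      · subst hvb
        exact absurd (hflip _ _ hb) (by simpa [hba] using hv)
      · exact ⟨by simpa [hva, hvb] using hv, hva⟩
  refine ih _ ?_ D' ?_ (fun u v hu hv => hreach u v (hsub u hu).1 (hsub v hv).1) rfl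
  · rw [← hn]
    refine card_lt_card ⟨fun v hv => ?_, fun h => ?_⟩
    · simp only [mem_filter, mem_univ, true_and] at hv ⊢
      exact (hsub v hv).1
    · have := h (mem_filter.2 ⟨mem_univ a, ha⟩)
      simp only [mem_filter, mem_univ, true_and] at this
      exact (hsub a this).2 rfl
  · simp_rw [hD', sum_add_distrib, hsum]
    rw [sum_pi_single' a, sum_pi_single' b]
    simp [CharTwo.add_self_eq_zero]

end Orientation

section Pieces

variable {G : SimpleGraph V}

theorem sum_sdeg [Fintype V] (H : G.Subgraph) : ∑ v, sdeg H v = 2 * H.edgeSet.ncard := by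
  classical
  have h := H.spanningCoe.sum_degrees_eq_twice_card_edges
  rw [← Set.ncard_coe_finset, coe_edgeFinset, Subgraph.edgeSet_spanningCoe] at h
  rw [← h]
  refine sum_congr rfl fun v _ => ?_
  rw [← card_neighborSet_eq_degree, ← Set.toFinset_card, ← Set.ncard_eq_toFinset_card']
  rfl

theorem IsCycleSG.ncard_verts [Fintype V] {C : G.Subgraph} (hC : IsCycleSG C) :
    C.verts.ncard = C.edgeSet.ncard := by
  classical
  have h := sum_sdeg C
  have h' : ∀ v, sdeg C v = if v ∈ C.verts then 2 else 0 := fun v => by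
    split_ifs with hv
    · exact hC.2 v hv
    · have : C.neighborSet v = ∅ := Set.eq_empty_iff_forall_notMem.2 fun u hu =>
        hv (C.edge_vert hu)
      rw [sdeg, this, Set.ncard_empty]
  simp_rw [h'] at h
  rw [← sum_filter, sum_const, smul_eq_mul, mul_comm] at h
  rw [Set.ncard_eq_toFinset_card', ← Nat.eq_of_mul_eq_mul_left two_pos h]
  congr 1
  ext
  simp

theorem IsCycleSG.three_le_ncard_verts [Fintype V] {C : G.Subgraph} (hC : IsCycleSG C) :
    3 ≤ C.verts.ncard := by
  obtain ⟨v, hv⟩ := hC.1.nonempty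
  have h : insert v (C.neighborSet v) ⊆ C.verts :=
    Set.insert_subset hv fun u hu => C.edge_vert (C.adj_symm hu)
  have h2 : (C.neighborSet v).ncard = 2 := hC.2 v hv
  have := Set.ncard_le_ncard h
  have hnot : v ∉ C.neighborSet v := fun hu => (C.adj_sub hu).ne rfl
  rwa [Set.ncard_insert_of_notMem hnot, h2] at this

/-- A connected subgraph with oddly many edges can be oriented so that the vertices of odd
indegree are those of any prescribed odd set of its vertices. -/
theorem exists_orient_of_odd_subset [Fintype V] [DecidableEq V] {H : G.Subgraph}
    (hH : H.Connected) (hodd : Odd H.edgeSet.ncard) {T : Finset V} (hT : ∀ v ∈ T, v ∈ H.verts)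
    (hTodd : Odd #T) :
    ∃ D : Orient H.spanningCoe, ∀ v, (indeg D v : ZMod 2) = if v ∈ T then 1 else 0 := by
  obtain ⟨D⟩ := exists_orient H.spanningCoe
  have hmem : ∀ v, (indeg D v : ZMod 2) ≠ (if v ∈ T then 1 else 0) → v ∈ H.verts := by
    intro v hv
    by_contra hvH
    have hempty : {u | D.dir u v} = ∅ := Set.eq_empty_iff_forall_notMem.2 fun u hu =>
      hvH (H.edge_vert (H.adj_symm ((D.adj_iff u v).2 (Or.inl hu))))
    exact hv (by rw [indeg, hempty, if_neg fun h => hvH (hT v h)]; simp)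
  refine exists_orient_of_parity D _ ?_ fun a b ha hb => ?_
  · rw [← Nat.cast_sum, sum_indeg, Subgraph.edgeSet_spanningCoe,
      (ZMod.natCast_eq_one_iff_odd).2 hodd, sum_ite_mem, univ_inter, sum_const, nsmul_one,
      (ZMod.natCast_eq_one_iff_odd).2 hTodd]
  · exact (hH.coe.preconnected ⟨a, hmem a ha⟩ ⟨b, hmem b hb⟩).map
      ⟨Subtype.val, fun h => h⟩

/-- The cycles of `𝒪` together with the single edges lying on none of them. -/
def pieces (𝒪 : Set G.Subgraph) : Set G.Subgraph :=
  𝒪 ∪ {x | ∃ u v, ∃ h : G.Adj u v, x = G.subgraphOfAdj h ∧ ∀ O ∈ 𝒪, ¬ O.Adj u v}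

variable {𝒪 : Set G.Subgraph}

theorem exists_piece_adj {u v : V} (h : G.Adj u v) : ∃ x ∈ pieces 𝒪, x.Adj u v := by
  by_cases hO : ∃ O ∈ 𝒪, O.Adj u v
  · obtain ⟨O, hO, huv⟩ := hO
    exact ⟨O, Or.inl hO, huv⟩
  · push Not at hO
    exact ⟨G.subgraphOfAdj h, Or.inr ⟨u, v, h, rfl, hO⟩, by simp⟩

theorem piece_unique (hdisj : PairwiseEdgeDisjoint 𝒪) {x y : G.Subgraph} (hx : x ∈ pieces 𝒪)
    (hy : y ∈ pieces 𝒪) {u v : V} (hxa : x.Adj u v) (hya : y.Adj u v) : x = y := by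
  have key : ∀ {a b : V} (h : G.Adj a b), (∀ O ∈ 𝒪, ¬ O.Adj a b) → (G.subgraphOfAdj h).Adj u v →
      ∀ O ∈ 𝒪, ¬ O.Adj u v := by
    intro a b h hO huv O hOm hadj
    rw [subgraphOfAdj_adj] at huv
    refine hO O hOm ?_
    rw [← Subgraph.mem_edgeSet] at hadj ⊢
    rwa [huv]
  rcases hx with hx | ⟨a, b, hab, rfl, hx⟩ <;> rcases hy with hy | ⟨c, d, hcd, rfl, hy⟩
  · by_contra hne
    exact Set.disjoint_left.1 (hdisj hx hy hne) (Subgraph.mem_edgeSet.2 hxa)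
      (Subgraph.mem_edgeSet.2 hya)
  · exact absurd hxa (key hcd hy hya x hx)
  · exact absurd hya (key hab hx hxa y hy)
  · rw [subgraphOfAdj_adj] at hxa hya
    rcases Sym2.eq_iff.1 (hxa.trans hya.symm) with ⟨rfl, rfl⟩ | ⟨rfl, rfl⟩
    · rfl
    · exact subgraphOfAdj_symm _

theorem piece_connected (hodd : ∀ O ∈ 𝒪, IsOddCycleSG O) {x : G.Subgraph} (hx : x ∈ pieces 𝒪) :
    x.Connected := by
  rcases hx with hx | ⟨u, v, h, rfl, -⟩
  · exact (hodd x hx).1.1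
  · exact Subgraph.subgraphOfAdj_connected h

theorem piece_odd (hodd : ∀ O ∈ 𝒪, IsOddCycleSG O) {x : G.Subgraph} (hx : x ∈ pieces 𝒪) :
    Odd x.edgeSet.ncard := by
  rcases hx with hx | ⟨u, v, h, rfl, -⟩
  · exact (hodd x hx).2
  · simp

open Classical in
/-- The degree of the vertices of a piece. -/
noncomputable def pieceDeg (𝒪 : Set G.Subgraph) (x : G.Subgraph) : ℕ := if x ∈ 𝒪 then 2 else 1

theorem sdeg_piece (hodd : ∀ O ∈ 𝒪, IsOddCycleSG O) {x : G.Subgraph} (hx : x ∈ pieces 𝒪) {v : V}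
    (hv : v ∈ x.verts) : sdeg x v = pieceDeg 𝒪 x := by
  rw [pieceDeg]
  split_ifs with hxO
  · exact (hodd x hxO).1.2 v hv
  · rcases hx with hx | ⟨a, b, h, rfl, -⟩
    · exact absurd hx hxO
    · have hv' : v = a ∨ v = b := by simpa using hv
      rcases hv' with rfl | rfl <;> simp [sdeg]

theorem piece_size [Fintype V] (hodd : ∀ O ∈ 𝒪, IsOddCycleSG O) {x : G.Subgraph}
    (hx : x ∈ pieces 𝒪) : (pieceDeg 𝒪 x = 1 ∧ x.verts.ncard = 2) ∨
      (pieceDeg 𝒪 x = 2 ∧ Odd x.verts.ncard ∧ 3 ≤ x.verts.ncard) := by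
  rw [pieceDeg]
  split_ifs with hxO
  · have hC := (hodd x hxO).1
    exact Or.inr ⟨rfl, hC.ncard_verts ▸ (hodd x hxO).2, hC.three_le_ncard_verts⟩
  · rcases hx with hx | ⟨a, b, h, rfl, -⟩
    · exact absurd hx hxO
    · exact Or.inl ⟨rfl, Set.ncard_pair h.ne⟩

theorem isCycleSystem_pieces [Fintype V] [DecidableEq V] [Fintype (pieces 𝒪)] {t : ℕ}
    (hte : Even t) (hconn : TwoConnected G) (hreg : IsRegular G (2 * t))
    (hodd : ∀ O ∈ 𝒪, IsOddCycleSG O) (hdisj : PairwiseEdgeDisjoint 𝒪) {I : pieces 𝒪 → Finset V}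
    (hI : ∀ x v, v ∈ I x ↔ v ∈ x.1.verts) :
    IsCycleSystem I fun x => pieceDeg 𝒪 x.1 where
  size x := by
    have hIx : (I x : Set V) = x.1.verts := Set.ext fun v => hI x v
    simpa only [← hIx, Set.ncard_coe_finset] using piece_size hodd x.2
  four_dvd v := by
    classical
    have h : #(univ.biUnion fun x : pieces 𝒪 => (x.1.neighborSet v).toFinset) = 2 * t := by
      rw [← hreg v, Set.ncard_eq_toFinset_card']
      congr 1
      ext u
      simp only [mem_biUnion, mem_univ, true_and, Set.mem_toFinset, Subgraph.mem_neighborSet,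
        mem_neighborSet]
      refine ⟨fun ⟨x, hx⟩ => x.1.adj_sub hx, fun hu => ?_⟩
      obtain ⟨x, hx, hxa⟩ := exists_piece_adj (𝒪 := 𝒪) hu
      exact ⟨⟨x, hx⟩, hxa⟩
    rw [card_biUnion] at h
    · have hsum : ∑ x with v ∈ I x, pieceDeg 𝒪 x.1 = 2 * t := by
        rw [← h, sum_filter]
        refine sum_congr rfl fun x _ => ?_
        rw [← Set.ncard_eq_toFinset_card']
        split_ifs with hv
        · exact (sdeg_piece hodd x.2 ((hI x v).1 hv)).symm
        · have : x.1.neighborSet v = ∅ := Set.eq_empty_iff_forall_notMem.2 fun u hu =>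
            hv ((hI x v).2 (x.1.edge_vert hu))
          rw [this, Set.ncard_empty]
      rw [hsum]
      obtain ⟨s, rfl⟩ := hte
      exact ⟨s, by ring⟩
    · intro x _ y _ hne
      refine Finset.disjoint_left.2 fun u hu hu' => hne (Subtype.ext ?_)
      rw [Set.mem_toFinset] at hu hu'
      exact piece_unique hdisj x.2 y.2 hu hu'
  no_cut v A := by
    rintro ⟨y, hyA, hyv⟩ ⟨z, hz⟩ hvA
    have hzv : z ≠ v := fun h => hz (h ▸ hvA)
    obtain ⟨p⟩ := (hconn.2.2 v).preconnected ⟨y, hyv⟩ ⟨z, hzv⟩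
    obtain ⟨d, -, hd1, hd2⟩ := p.exists_boundary_dart {a | a.1 ∈ A} hyA hz
    obtain ⟨x, hx, hxa⟩ := exists_piece_adj (𝒪 := 𝒪) (u := d.fst.1) (v := d.snd.1) d.adj
    exact ⟨⟨x, hx⟩, d.fst.1, (hI _ _).2 (x.edge_vert hxa), d.snd.1,
      (hI _ _).2 (x.edge_vert hxa.symm), hd1, d.fst.2, hd2⟩

end Pieces

section Gluing

variable {G : SimpleGraph V} {𝒪 : Set G.Subgraph}

/-- The orientation of `G` glued from orientations of the pieces. -/
def glue (hdisj : PairwiseEdgeDisjoint 𝒪) (D : ∀ x : pieces 𝒪, Orient x.1.spanningCoe) :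
    Orient G where
  dir u v := ∃ x, (D x).dir u v
  adj_iff u v := by
    rw [← exists_or]
    simp_rw [← Orient.adj_iff, Subgraph.spanningCoe_adj]
    refine ⟨fun h => ?_, fun ⟨x, hx⟩ => x.1.adj_sub hx⟩
    obtain ⟨x, hx, hxa⟩ := exists_piece_adj (𝒪 := 𝒪) h
    exact ⟨⟨x, hx⟩, hxa⟩
  asymm := by
    rintro u v ⟨x, hx⟩ ⟨y, hy⟩
    obtain rfl : x = y := Subtype.ext <| piece_unique hdisj x.2 y.2 (u := u) (v := v)
      (((D x).adj_iff u v).2 (Or.inl hx)) (((D y).adj_iff u v).2 (Or.inr hy))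
    exact (D x).asymm _ _ hx hy

theorem dir_of_glue {hdisj : PairwiseEdgeDisjoint 𝒪}
    {D : ∀ x : pieces 𝒪, Orient x.1.spanningCoe} {x : pieces 𝒪} {u v : V} :
    x.1.Adj u v ∧ (glue hdisj D).dir u v ↔ (D x).dir u v := by
  constructor
  · rintro ⟨hx, y, hy⟩
    obtain rfl : x = y := Subtype.ext <| piece_unique hdisj x.2 y.2 hx
      (((D y).adj_iff u v).2 (Or.inl hy))
    exact hy
  · exact fun h => ⟨((D x).adj_iff u v).2 (Or.inl h), x, h⟩

theorem indeg_glue [Fintype V] [Fintype (pieces 𝒪)] (hdisj : PairwiseEdgeDisjoint 𝒪)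
    (D : ∀ x : pieces 𝒪, Orient x.1.spanningCoe) (v : V) :
    indeg (glue hdisj D) v = ∑ x, indeg (D x) v := by
  classical
  simp_rw [indeg, Set.ncard_eq_toFinset_card']
  rw [← card_biUnion]
  · congr 1
    ext u
    simp [glue]
  · intro x _ y _ hne
    refine Finset.disjoint_left.2 fun u hu hu' => hne ?_
    simp only [Set.mem_toFinset, Set.mem_ofPred_eq] at hu hu'
    exact Subtype.ext <| piece_unique hdisj x.2 y.2 (u := u) (v := v)
      (((D x).adj_iff u v).2 (Or.inl hu)) (((D y).adj_iff u v).2 (Or.inl hu'))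

end Gluing

end EvenIndegree

/-- A 2-connected 2t-regular graph (`t` even, `t ≥ 2`) with a set of pairwise
edge-disjoint odd cycles admits an orientation with all indegrees even in which no
cycle of the set is an oriented cycle. -/
theorem stmt_6 {V : Type*} [Fintype V] (t : ℕ) (ht : 2 ≤ t) (hte : Even t)
    (G : SimpleGraph V)
    (hconn : TwoConnected G) (hreg : IsRegular G (2 * t))
    (𝒪 : Set G.Subgraph) (hodd : ∀ O ∈ 𝒪, IsOddCycleSG O)
    (hdisj : PairwiseEdgeDisjoint 𝒪) :
    ∃ D : Orient G, (∀ v : V, Even (indeg D v)) ∧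
      ∀ O ∈ 𝒪, ¬ IsOrientedCycle D O := by
  classical
  have : Fintype (pieces 𝒪) := Fintype.ofFinite _
  let I : pieces 𝒪 → Finset V := fun x => x.1.verts.toFinset
  have hI : ∀ x v, v ∈ I x ↔ v ∈ x.1.verts := fun x v => Set.mem_toFinset
  obtain ⟨T, hT, hTeven⟩ :=
    (isCycleSystem_pieces hte hconn hreg hodd hdisj hI).exists_odd_subsets
  choose D hD using fun x : pieces 𝒪 => exists_orient_of_odd_subset (piece_connected hodd x.2)
    (piece_odd hodd x.2) (fun v hv => (hI x v).1 ((hT x).1 hv)) (hT x).2.1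
  refine ⟨glue hdisj D, fun v => ?_, fun O hO hcyc => ?_⟩
  · rw [← ZMod.natCast_eq_zero_iff_even, indeg_glue, Nat.cast_sum]
    simp_rw [hD]
    rw [Finset.sum_boole, ZMod.natCast_eq_zero_iff_even]
    exact hTeven v
  · let x : pieces 𝒪 := ⟨O, Or.inl hO⟩
    obtain ⟨v, hvI, hvT⟩ := Finset.exists_of_ssubset ((hT x).1.ssubset_of_ne (hT x).2.2)
    obtain ⟨u, hu, huniq⟩ := hcyc v ((hI x v).1 hvI)
    have hset : {a | (D x).dir a v} = {u} := Set.ext fun a => by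
      rw [Set.mem_ofPred_eq, Set.mem_singleton_iff, ← dir_of_glue (hdisj := hdisj)]
      exact ⟨fun h => huniq a h, fun h => h ▸ hu⟩
    have h := hD x v
    rw [if_neg hvT, indeg, hset, Set.ncard_singleton] at h
    exact absurd h (by decide)

end PaperFormalization
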